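/- Let X be a real random variable with finite variance and let t_{σ,a} denote the randomized discretization defined by adding an independent N(0,σ²) and rounding to the grid (1/a)ℤ ∩ [−a, a] (with stochastic rounding between adjacent grid points, and clamping at ±a). Then E_ν( H(t_{σ,a}(x)) ) = log a + D(N(0,σ)) + o(1) as a → ∞, where ν is the law of X, H is Shannon entropy of the resulting discrete distribution, and D(N(0,σ)) = (1/2)log(2πeσ²). -/

import Mathlib

open MeasureTheory ProbabilityTheory Real Filter

/-- `discProb σ a x r` is the probability that the randomized discretization `t_{σ,a}(x)`
equals the grid point `r/a`: first an independent `N(0,σ²)` noise is added to `x`, the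
result is clamped to `[−a, a]`, and then it is rounded stochastically to one of the two
nearest points of the grid `(1/a)ℤ`. -/
noncomputable def discProb (σ : ℝ) (a : ℕ) (x : ℝ) (r : ℤ) : ℝ :=
  ∫ z, max 0 (1 - |(max (-(a : ℝ)) (min (a : ℝ) (x + σ * z))) * a - (r : ℝ)|)
    ∂(gaussianReal 0 1)

/-- The Shannon entropy `H(t_{σ,a}(x))` of the discretized value. -/
noncomputable def discEntropy (σ : ℝ) (a : ℕ) (x : ℝ) : ℝ :=
  ∑' r : ℤ, Real.negMulLog (discProb σ a x r)

/-- The tent function `u ↦ (1 - |u|)⁺`. -/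
noncomputable def tent (u : ℝ) : ℝ := max 0 (1 - |u|)

lemma tent_nonneg (u : ℝ) : 0 ≤ tent u := le_max_left _ _

lemma tent_le_one (u : ℝ) : tent u ≤ 1 := max_le zero_le_one (by linarith [abs_nonneg u])

lemma tent_eq_zero {u : ℝ} (h : 1 ≤ |u|) : tent u = 0 := max_eq_left (by linarith)

lemma tent_of_abs_le {u : ℝ} (h : |u| ≤ 1) : tent u = 1 - |u| := max_eq_right (by linarith)

@[fun_prop]
lemma continuous_tent : Continuous tent := by
  unfold tent
  fun_prop

lemma sum_tent_mul {u : ℝ} {m n : ℤ} (hm : m ≤ ⌊u⌋) (hn : ⌊u⌋ + 1 ≤ n) (F : ℤ → ℝ) :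
    ∑ r ∈ Finset.Icc m n, tent (u - r) * F r
      = (1 - Int.fract u) * F ⌊u⌋ + Int.fract u * F (⌊u⌋ + 1) := by
  have h0 := Int.fract_nonneg u
  have h1 := (Int.fract_lt_one u).le
  have hfl : u - (⌊u⌋ : ℝ) = Int.fract u := Int.self_sub_floor u
  have hsub : ({⌊u⌋, ⌊u⌋ + 1} : Finset ℤ) ⊆ Finset.Icc m n := by
    intro r hr
    simp only [Finset.mem_insert, Finset.mem_singleton] at hr
    rw [Finset.mem_Icc]
    omega
  rw [← Finset.sum_subset hsub, Finset.sum_pair (by omega)]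
  · have e1 : tent (u - (⌊u⌋ : ℝ)) = 1 - Int.fract u := by
      rw [hfl, tent_of_abs_le (by rwa [abs_of_nonneg h0]), abs_of_nonneg h0]
    have e2 : tent (u - ((⌊u⌋ + 1 : ℤ) : ℝ)) = Int.fract u := by
      have : u - ((⌊u⌋ + 1 : ℤ) : ℝ) = Int.fract u - 1 := by push_cast; linarith
      have hle : Int.fract u - 1 ≤ 0 := by linarith
      rw [this, tent_of_abs_le (by rw [abs_of_nonpos hle]; linarith), abs_of_nonpos hle]
      ring
    rw [e1, e2]
  · intro r _ hr
    simp only [Finset.mem_insert, Finset.mem_singleton, not_or] at hr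
    rw [tent_eq_zero, zero_mul]
    rcases lt_or_gt_of_ne hr.1 with h | h
    · have : (r : ℝ) + 1 ≤ ⌊u⌋ := by exact_mod_cast h
      exact le_trans (by linarith) (le_abs_self _)
    · have : (⌊u⌋ : ℝ) + 2 ≤ r := by
        have : ⌊u⌋ + 2 ≤ r := by omega
        exact_mod_cast this
      exact le_trans (by linarith) (neg_le_abs _)

lemma sum_tent {u : ℝ} {m n : ℤ} (hm : m ≤ ⌊u⌋) (hn : ⌊u⌋ + 1 ≤ n) :
    ∑ r ∈ Finset.Icc m n, tent (u - r) = 1 := by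
  simpa using sum_tent_mul hm hn (fun _ => 1)

lemma sum_tent_le_one (u : ℝ) (s : Finset ℤ) : ∑ r ∈ s, tent (u - r) ≤ 1 := by
  have key : ∑ r ∈ s, tent (u - r) ≤ ∑ r ∈ s ∪ Finset.Icc ⌊u⌋ (⌊u⌋ + 1), tent (u - r) :=
    Finset.sum_le_sum_of_subset_of_nonneg Finset.subset_union_left fun _ _ _ => tent_nonneg _
  refine key.trans (le_of_eq ?_)
  rw [← sum_tent (u := u) le_rfl le_rfl]
  symm
  refine Finset.sum_subset Finset.subset_union_right fun r _ hr => tent_eq_zero ?_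
  rw [Finset.mem_Icc, not_and_or, not_le, not_le] at hr
  have hf := Int.floor_le u
  have hf' := Int.lt_floor_add_one u
  rcases hr with h | h
  · have : (r : ℝ) + 1 ≤ ⌊u⌋ := by exact_mod_cast h
    exact le_trans (by linarith) (le_abs_self _)
  · have : (⌊u⌋ : ℝ) + 2 ≤ r := by
      have : ⌊u⌋ + 2 ≤ r := by omega
      exact_mod_cast this
    exact le_trans (by linarith) (neg_le_abs _)

lemma integral_tent : ∫ u, tent u = 1 := by
  have hsupp : ∀ u, u ∉ Set.Ioc (-1 : ℝ) 1 → tent u = 0 := by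
    intro u hu
    apply tent_eq_zero
    by_contra! h
    exact hu ⟨(abs_lt.1 h).1, (abs_lt.1 h).2.le⟩
  rw [← setIntegral_eq_integral_of_forall_compl_eq_zero hsupp,
    ← intervalIntegral.integral_of_le (by norm_num),
    ← intervalIntegral.integral_add_adjacent_intervals (b := 0)
      (continuous_tent.intervalIntegrable _ _) (continuous_tent.intervalIntegrable _ _)]
  have e1 : ∫ u in (-1 : ℝ)..0, tent u = ∫ u in (-1 : ℝ)..0, (1 + u) := by
    refine intervalIntegral.integral_congr fun u hu => ?_
    rw [Set.uIcc_of_le (by norm_num)] at hu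
    have := abs_of_nonpos hu.2
    simp only [tent_of_abs_le (by rw [this]; linarith [hu.1]), this, sub_neg_eq_add]
  have e2 : ∫ u in (0 : ℝ)..1, tent u = ∫ u in (0 : ℝ)..1, (1 - u) := by
    refine intervalIntegral.integral_congr fun u hu => ?_
    rw [Set.uIcc_of_le (by norm_num)] at hu
    have := abs_of_nonneg hu.1
    simp only [tent_of_abs_le (by rw [this]; linarith [hu.2]), this]
  rw [e1, e2, intervalIntegral.integral_add (by simp) (by simp),
    intervalIntegral.integral_sub (by simp) (by simp)]
  norm_num

lemma integrable_tent : Integrable tent :=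
  Integrable.of_integral_ne_zero (by rw [integral_tent]; norm_num)

lemma integral_tent_mul_add {α : ℝ} (hα : 0 < α) (β : ℝ) : ∫ z, tent (α * z + β) = 1 / α := by
  rw [Measure.integral_comp_mul_left (fun z => tent (z + β)) α, integral_add_right_eq_self,
    integral_tent, abs_of_pos (inv_pos.2 hα)]
  simp

lemma integrable_tent_mul_add {α : ℝ} (hα : 0 < α) (β : ℝ) :
    Integrable fun z => tent (α * z + β) :=
  (integrable_tent.comp_add_right β).comp_mul_left' hα.ne'

/-- Gibbs' pointwise inequality. -/
lemma negMulLog_le {p q : ℝ} (hp : 0 ≤ p) (hq : 0 < q) :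
    negMulLog p ≤ -p * log q + (q - p) := by
  rcases hp.eq_or_lt with rfl | hp
  · simpa using hq.le
  · have h := log_le_sub_one_of_pos (div_pos hq hp)
    rw [log_div hq.ne' hp.ne'] at h
    have h2 := mul_le_mul_of_nonneg_left h hp.le
    have : p * (q / p - 1) = q - p := by field_simp
    rw [negMulLog]
    linarith

lemma log_gaussianPDFReal_zero_one (z : ℝ) :
    log (gaussianPDFReal 0 1 z) = -(1 / 2 * log (2 * π)) - z ^ 2 / 2 := by
  rw [gaussianPDFReal, log_mul (by positivity) (by positivity), log_inv, log_sqrt (by positivity),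
    log_exp]
  simp
  ring

lemma integrable_pow_gaussianReal (n : ℕ) : Integrable (fun z : ℝ => z ^ n) (gaussianReal 0 1) := by
  have h := (memLp_id_gaussianReal (μ := 0) (v := 1) (n : NNReal))
  have h2 := MemLp.integrable_norm_pow' (p := n) (by simpa using h)
  refine h2.mono' (by fun_prop) (ae_of_all _ fun z => ?_)
  simp

lemma integral_sq_gaussianReal : ∫ z : ℝ, z ^ 2 ∂(gaussianReal 0 1) = 1 := by
  have h := variance_id_gaussianReal (μ := 0) (v := 1)
  rw [variance_of_integral_eq_zero (by fun_prop) (by simp)] at h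
  simpa using h

lemma gaussianPDFReal_mul_le_intervalIntegral (c : ℝ) {δ : ℝ} (hδ : 0 < δ) :
    δ * gaussianPDFReal 0 1 c * exp (-(δ ^ 2 / 8))
      ≤ ∫ y in (c - δ / 2)..(c + δ / 2), gaussianPDFReal 0 1 y := by
  set A := gaussianPDFReal 0 1 c * exp (-(δ ^ 2 / 8)) with hA
  have hint : ∫ y in (c - δ / 2)..(c + δ / 2), A * (1 - c * (y - c)) = A * δ := by
    rw [intervalIntegral.integral_const_mul,
      intervalIntegral.integral_sub (by simp)
        ((Continuous.intervalIntegrable (by fun_prop) _ _)),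
      intervalIntegral.integral_const_mul,
      intervalIntegral.integral_sub (by simp) (by simp), integral_id]
    ring_nf
    simp
    ring
  have : δ * gaussianPDFReal 0 1 c * exp (-(δ ^ 2 / 8)) = A * δ := by rw [hA]; ring
  rw [this, ← hint]
  refine intervalIntegral.integral_mono_on (by linarith)
    (Continuous.intervalIntegrable (by fun_prop) _ _)
    (integrable_gaussianPDFReal 0 1).intervalIntegrable fun y hy => ?_
  have hs : (y - c) ^ 2 ≤ (δ / 2) ^ 2 := sq_le_sq' (by linarith [hy.1]) (by linarith [hy.2])
  have e : gaussianPDFReal 0 1 y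
      = gaussianPDFReal 0 1 c * exp (-((y - c) ^ 2 / 2)) * exp (-(c * (y - c))) := by
    simp only [gaussianPDFReal]
    simp only [mul_assoc, ← exp_add]
    congr 2
    simp only [NNReal.coe_one]
    ring
  have hc := (gaussianPDFReal_pos 0 1 c one_ne_zero)
  rw [e, hA]
  calc gaussianPDFReal 0 1 c * exp (-(δ ^ 2 / 8)) * (1 - c * (y - c))
      ≤ gaussianPDFReal 0 1 c * exp (-(δ ^ 2 / 8)) * exp (-(c * (y - c))) := by
        gcongr
        linarith [add_one_le_exp (-(c * (y - c)))]
    _ ≤ _ := by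
        have : exp (-(δ ^ 2 / 8)) ≤ exp (-((y - c) ^ 2 / 2)) := exp_le_exp.2 (by linarith)
        gcongr

lemma sum_gaussianPDFReal_le (b : ℝ) {δ : ℝ} (hδ : 0 < δ) (s : Finset ℤ) :
    ∑ r ∈ s, δ * gaussianPDFReal 0 1 (r * δ - b) ≤ exp (δ ^ 2 / 8) := by
  have hcell : ∀ r : ℤ, δ * gaussianPDFReal 0 1 (r * δ - b) * exp (-(δ ^ 2 / 8))
      ≤ ∫ y in Set.Ioc (-b - δ / 2 + r • δ) (-b - δ / 2 + (r + 1) • δ),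
          gaussianPDFReal 0 1 y := by
    intro r
    refine (gaussianPDFReal_mul_le_intervalIntegral _ hδ).trans (le_of_eq ?_)
    rw [intervalIntegral.integral_of_le (by linarith)]
    congr 3
    · simp only [zsmul_eq_mul]; ring
    · simp only [zsmul_eq_mul]; push_cast; ring
  have hsum : ∑ r ∈ s, ∫ y in Set.Ioc (-b - δ / 2 + r • δ) (-b - δ / 2 + (r + 1) • δ),
      gaussianPDFReal 0 1 y ≤ 1 := by
    rw [← integral_biUnion_finset s (fun _ _ => measurableSet_Ioc)
      (fun i _ j _ hij => Set.pairwise_disjoint_Ioc_add_zsmul _ _ hij)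
      (fun _ _ => (integrable_gaussianPDFReal 0 1).integrableOn),
      ← integral_gaussianPDFReal_eq_one 0 one_ne_zero]
    exact setIntegral_le_integral (integrable_gaussianPDFReal 0 1)
      (ae_of_all _ (gaussianPDFReal_nonneg 0 1))
  have h := (Finset.sum_le_sum fun r (_ : r ∈ s) => hcell r).trans hsum
  rw [← Finset.sum_mul, exp_neg, ← div_eq_mul_inv, div_le_one (exp_pos _)] at h
  exact h

lemma integrable_tent_comp_mul {f : ℝ → ℝ} {μ : Measure ℝ} (hf : Integrable f μ) {g : ℝ → ℝ}
    (hg : Continuous g) : Integrable (fun z => tent (g z) * f z) μ := by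
  refine hf.bdd_mul (c := 1) (by fun_prop) (ae_of_all _ fun z => ?_)
  rw [norm_of_nonneg (tent_nonneg _)]
  exact tent_le_one _

lemma integral_le_negMulLog_integral_tent {α : ℝ} (hα : 0 < α) (β : ℝ) :
    ∫ z, tent (α * z + β) * (log α + 1 / 2 * log (2 * π) + z ^ 2 / 2) ∂(gaussianReal 0 1)
      ≤ negMulLog (∫ z, tent (α * z + β) ∂(gaussianReal 0 1)) := by
  set p := ∫ z, tent (α * z + β) ∂(gaussianReal 0 1) with hp
  have hp0 : 0 ≤ p := integral_nonneg fun _ => tent_nonneg _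
  have hw : Integrable (fun z => tent (α * z + β)) (gaussianReal 0 1) := by
    simpa using integrable_tent_comp_mul (integrable_const (1 : ℝ)) (g := fun z => α * z + β)
      (by fun_prop)
  have hwsq : Integrable (fun z => tent (α * z + β) * (1 / 2 * log (2 * π) + z ^ 2 / 2))
      (gaussianReal 0 1) :=
    integrable_tent_comp_mul
      ((integrable_const _).add ((integrable_pow_gaussianReal 2).div_const 2)) (by fun_prop)
  rcases hp0.eq_or_lt with h0 | hpos
  · have hz := (integral_eq_zero_iff_of_nonneg (fun _ => tent_nonneg _) hw).1 h0.symm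
    rw [← h0, negMulLog_zero, integral_eq_zero_of_ae]
    filter_upwards [hz] with z hz
    simp only [Pi.zero_apply] at hz ⊢
    rw [hz, zero_mul]
  · have hpd : p = ∫ z, gaussianPDFReal 0 1 z * tent (α * z + β) := by
      rw [hp, integral_gaussianReal_eq_integral_smul one_ne_zero]
      rfl
    have hpdi : Integrable fun z => gaussianPDFReal 0 1 z * tent (α * z + β) :=
      Integrable.of_integral_ne_zero (by rw [← hpd]; exact hpos.ne')
    have hti := integrable_tent_mul_add hα β
    have hsubI : Integrable fun z =>
        α * p * tent (α * z + β) - gaussianPDFReal 0 1 z * tent (α * z + β) :=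
      (hti.const_mul _).sub hpdi
    have key : ∫ z, tent (α * z + β) * (1 / 2 * log (2 * π) + z ^ 2 / 2) ∂(gaussianReal 0 1)
        ≤ -p * log (α * p) := by
      rw [integral_gaussianReal_eq_integral_smul one_ne_zero]
      have hr : ∫ z, (-log (α * p) * (gaussianPDFReal 0 1 z * tent (α * z + β))
          + (α * p * tent (α * z + β) - gaussianPDFReal 0 1 z * tent (α * z + β)))
          = -p * log (α * p) := by
        rw [integral_add (hpdi.const_mul _) hsubI,
          integral_sub (hti.const_mul _) hpdi, integral_const_mul, integral_const_mul, ← hpd,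
          integral_tent_mul_add hα]
        field_simp
        ring
      rw [← hr]
      refine integral_mono_of_nonneg (ae_of_all _ fun z => ?_)
        ((hpdi.const_mul _).add hsubI) (ae_of_all _ fun z => ?_)
      · have : 0 ≤ log (2 * π) := log_nonneg (by linarith [pi_gt_three])
        exact smul_nonneg (gaussianPDFReal_nonneg _ _ _)
          (mul_nonneg (tent_nonneg _) (by positivity))
      · have h := negMulLog_le (gaussianPDFReal_nonneg 0 1 z) (mul_pos hα hpos)
        rw [negMulLog, log_gaussianPDFReal_zero_one] at h
        have h2 := mul_le_mul_of_nonneg_right h (tent_nonneg (α * z + β))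
        simp only [smul_eq_mul]
        linarith
    have hsplit : ∫ z, tent (α * z + β) * (log α + 1 / 2 * log (2 * π) + z ^ 2 / 2)
        ∂(gaussianReal 0 1) = log α * p
          + ∫ z, tent (α * z + β) * (1 / 2 * log (2 * π) + z ^ 2 / 2) ∂(gaussianReal 0 1) := by
      rw [hp, ← integral_const_mul, ← integral_add (hw.const_mul _) hwsq]
      congr with z
      ring
    rw [hsplit, negMulLog]
    rw [log_mul hα.ne' hpos.ne'] at key
    linarith

/-- The truncation of a real number to `[-a, a]`. -/
noncomputable def clamp (a y : ℝ) : ℝ := max (-a) (min a y)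

@[fun_prop]
lemma continuous_clamp (a : ℝ) : Continuous (clamp a) := by
  unfold clamp
  fun_prop

lemma neg_le_clamp (a y : ℝ) : -a ≤ clamp a y := le_max_left _ _

lemma clamp_le {a : ℝ} (ha : 0 ≤ a) (y : ℝ) : clamp a y ≤ a :=
  max_le (by linarith) (min_le_left _ _)

lemma clamp_of_abs_le {a y : ℝ} (h : |y| ≤ a) : clamp a y = y := by
  rw [clamp, min_eq_right (abs_le.1 h).2, max_eq_right (abs_le.1 h).1]

lemma abs_clamp_sub_clamp_le (a x y : ℝ) : |clamp a x - clamp a y| ≤ |x - y| := by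
  have h1 := abs_max_sub_max_le_max (-a) (min a x) (-a) (min a y)
  have h2 := abs_min_sub_min_le_max a x a y
  rw [sub_self, abs_zero, max_eq_right (abs_nonneg (α := ℝ) _)] at h1 h2
  exact h1.trans h2

lemma clamp_sub_sq_le {a : ℝ} (ha : 0 ≤ a) (x s : ℝ) :
    (clamp a (x + s) - x) ^ 2 ≤ s ^ 2 + {x | a < |x|}.indicator (fun x => 4 * x ^ 2) x := by
  by_cases h : |x| ≤ a
  · rw [Set.indicator_of_notMem (by simpa using h), add_zero]
    have h1 := abs_clamp_sub_clamp_le a (x + s) x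
    rw [clamp_of_abs_le h, add_sub_cancel_left] at h1
    exact sq_le_sq.2 h1
  · push Not at h
    rw [Set.indicator_of_mem (by simpa using h)]
    have h1 : |clamp a (x + s) - x| ≤ 2 * |x| := by
      have : |clamp a (x + s)| ≤ a := abs_le.2 ⟨neg_le_clamp _ _, clamp_le ha _⟩
      linarith [abs_sub (clamp a (x + s)) x]
    have h2 : (clamp a (x + s) - x) ^ 2 ≤ (2 * |x|) ^ 2 := by
      rw [← sq_abs]
      gcongr
    rw [mul_pow, sq_abs] at h2
    nlinarith [sq_nonneg s]

lemma tent_clamp_mul_sub {a y : ℝ} (ha : 0 ≤ a) {r : ℝ} (h1 : -a ^ 2 + 1 ≤ r)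
    (h2 : r ≤ a ^ 2 - 1) : tent (clamp a y * a - r) = tent (y * a - r) := by
  rcases le_or_gt |y| a with h | h
  · rw [clamp_of_abs_le h]
  rcases lt_abs.1 h with h | h
  · have hc : clamp a y = a := by
      rw [clamp, min_eq_left h.le, max_eq_right (by linarith)]
    rw [hc, tent_eq_zero (le_trans (by nlinarith) (le_abs_self _)),
      tent_eq_zero (le_trans (by nlinarith) (le_abs_self _))]
  · have hc : clamp a y = -a := by
      rw [clamp, max_eq_left ((min_le_right _ _).trans (by linarith))]
    rw [hc, tent_eq_zero (le_trans (by nlinarith) (neg_le_abs _)),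
      tent_eq_zero (le_trans (by nlinarith) (neg_le_abs _))]

lemma discProb_eq (σ : ℝ) (a : ℕ) (x : ℝ) (r : ℤ) :
    discProb σ a x r = ∫ z, tent (clamp a (x + σ * z) * a - r) ∂(gaussianReal 0 1) := rfl

lemma integrable_tent_clamp (σ : ℝ) (a : ℕ) (x : ℝ) (r : ℤ) :
    Integrable (fun z => tent (clamp a (x + σ * z) * a - r)) (gaussianReal 0 1) := by
  simpa using integrable_tent_comp_mul (integrable_const (1 : ℝ))
    (g := fun z => clamp a (x + σ * z) * a - r) (by fun_prop)

lemma discProb_nonneg (σ : ℝ) (a : ℕ) (x : ℝ) (r : ℤ) : 0 ≤ discProb σ a x r :=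
  integral_nonneg fun _ => tent_nonneg _

lemma discProb_le_one (σ : ℝ) (a : ℕ) (x : ℝ) (r : ℤ) : discProb σ a x r ≤ 1 := by
  have h := integral_mono (integrable_tent_clamp σ a x r) (integrable_const (1 : ℝ))
    fun z => tent_le_one _
  simpa [discProb_eq] using h

lemma sum_discProb_mul (σ : ℝ) (a : ℕ) (x : ℝ) (s : Finset ℤ) (F : ℤ → ℝ) :
    ∑ r ∈ s, discProb σ a x r * F r
      = ∫ z, ∑ r ∈ s, tent (clamp a (x + σ * z) * a - r) * F r ∂(gaussianReal 0 1) := by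
  rw [integral_finsetSum _ fun r _ => (integrable_tent_clamp σ a x r).mul_const _]
  refine Finset.sum_congr rfl fun r _ => ?_
  rw [integral_mul_const, discProb_eq]

/-- A finite range of integers supporting the law of the discretization. -/
noncomputable def gridRange (a : ℕ) : Finset ℤ := Finset.Icc (-(a : ℤ) ^ 2) ((a : ℤ) ^ 2 + 1)

lemma neg_sq_le_floor_clamp (a : ℕ) (y : ℝ) : -(a : ℤ) ^ 2 ≤ ⌊clamp a y * a⌋ := by
  rw [Int.le_floor]
  push_cast
  nlinarith [neg_le_clamp a y, (Nat.cast_nonneg a : (0 : ℝ) ≤ a)]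

lemma floor_clamp_le_sq (a : ℕ) (y : ℝ) : ⌊clamp a y * a⌋ + 1 ≤ (a : ℤ) ^ 2 + 1 := by
  have h0 : (0 : ℝ) ≤ a := Nat.cast_nonneg a
  have h : clamp a y * a ≤ ((a ^ 2 : ℤ) : ℝ) := by
    push_cast
    nlinarith [clamp_le h0 y]
  have := Int.floor_le_floor h
  rw [Int.floor_intCast] at this
  linarith

lemma discProb_eq_zero (σ : ℝ) (a : ℕ) (x : ℝ) {r : ℤ} (hr : r ∉ gridRange a) :
    discProb σ a x r = 0 := by
  rw [discProb_eq]
  refine integral_eq_zero_of_ae (ae_of_all _ fun z => tent_eq_zero ?_)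
  have h0 : (0 : ℝ) ≤ a := Nat.cast_nonneg a
  have h1 := neg_le_clamp (a : ℝ) (x + σ * z)
  have h2 := clamp_le h0 (x + σ * z)
  rw [gridRange, Finset.mem_Icc, not_and_or, not_le, not_le] at hr
  rcases hr with h | h
  · have : (r : ℝ) + 1 ≤ -(a : ℝ) ^ 2 := by exact_mod_cast h
    exact le_trans (by nlinarith) (le_abs_self _)
  · have : (a : ℝ) ^ 2 + 1 ≤ r := by exact_mod_cast h.le
    exact le_trans (by nlinarith) (neg_le_abs _)

lemma discEntropy_eq_sum (σ : ℝ) (a : ℕ) (x : ℝ) :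
    discEntropy σ a x = ∑ r ∈ gridRange a, negMulLog (discProb σ a x r) :=
  tsum_eq_sum fun r hr => by rw [discProb_eq_zero σ a x hr, negMulLog_zero]

lemma stronglyMeasurable_discEntropy (σ : ℝ) (a : ℕ) : StronglyMeasurable (discEntropy σ a) := by
  have : discEntropy σ a
      = fun x => ∑ r ∈ gridRange a, negMulLog (discProb σ a x r) :=
    funext (discEntropy_eq_sum σ a)
  rw [this]
  refine Finset.stronglyMeasurable_fun_sum _ fun r _ =>
    continuous_negMulLog.comp_stronglyMeasurable ?_
  simp only [discProb_eq]
  refine StronglyMeasurable.integral_prod_right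
    (f := fun x z : ℝ => tent (clamp a (x + σ * z) * a - r)) ?_
  exact Continuous.stronglyMeasurable (by fun_prop)

lemma sum_discProb (σ : ℝ) (a : ℕ) (x : ℝ) : ∑ r ∈ gridRange a, discProb σ a x r = 1 := by
  have h := sum_discProb_mul σ a x (gridRange a) fun _ => 1
  simpa [gridRange, sum_tent (neg_sq_le_floor_clamp a _) (floor_clamp_le_sq a _)] using h

lemma sum_discProb_mul_sq_le {σ : ℝ} (hσ : 0 < σ) {a : ℕ} (ha : 1 ≤ a) (x : ℝ) :
    ∑ r ∈ gridRange a, discProb σ a x r * (r * (1 / (a * σ)) - x / σ) ^ 2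
      ≤ 1 + {x | (a : ℝ) < |x|}.indicator (fun x => 4 * x ^ 2) x / σ ^ 2 + (1 / (a * σ)) ^ 2 := by
  have ha0 : (0 : ℝ) < a := by exact_mod_cast ha
  rw [sum_discProb_mul]
  set B := {x | (a : ℝ) < |x|}.indicator (fun x => 4 * x ^ 2) x
  set δ := 1 / (a * σ) with hδ
  have hint : ∫ z : ℝ, (z ^ 2 + (B / σ ^ 2 + δ ^ 2)) ∂(gaussianReal 0 1)
      = 1 + B / σ ^ 2 + δ ^ 2 := by
    rw [integral_add (integrable_pow_gaussianReal 2) (integrable_const _),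
      integral_sq_gaussianReal]
    simp
    ring
  rw [← hint]
  refine integral_mono_of_nonneg
    (ae_of_all _ fun z => Finset.sum_nonneg fun r _ => mul_nonneg (tent_nonneg _) (sq_nonneg _))
    ((integrable_pow_gaussianReal 2).add (integrable_const _)) (ae_of_all _ fun z => ?_)
  simp only [gridRange]
  rw [sum_tent_mul (neg_sq_le_floor_clamp a _) (floor_clamp_le_sq a _)
    fun r => ((r : ℝ) * δ - x / σ) ^ 2]
  set u := clamp a (x + σ * z) * a with hu
  have hfl : (⌊u⌋ : ℝ) = u - Int.fract u := by linarith [Int.self_sub_floor u]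
  have h0 := Int.fract_nonneg u
  have h1 := (Int.fract_lt_one u).le
  push_cast
  rw [hfl]
  have hud : u * δ - x / σ = (clamp a (x + σ * z) - x) / σ := by
    rw [hu, hδ]
    field_simp
  have hsq : (u * δ - x / σ) ^ 2 ≤ z ^ 2 + B / σ ^ 2 := by
    rw [hud, div_pow, div_le_iff₀ (by positivity)]
    refine (clamp_sub_sq_le ha0.le x (σ * z)).trans (le_of_eq ?_)
    rw [add_mul, div_mul_cancel₀ _ (by positivity)]
    ring
  set θ := Int.fract u
  have e : (1 - θ) * ((u - θ) * δ - x / σ) ^ 2 + θ * ((u - θ + 1) * δ - x / σ) ^ 2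
      = (u * δ - x / σ) ^ 2 + θ * (1 - θ) * δ ^ 2 := by ring
  rw [e]
  have : θ * (1 - θ) * δ ^ 2 ≤ 1 * δ ^ 2 := by
    gcongr
    nlinarith
  linarith

lemma discEntropy_le {σ : ℝ} (hσ : 0 < σ) {a : ℕ} (ha : 1 ≤ a) (x : ℝ) :
    discEntropy σ a x ≤ log a + (log σ + 1 / 2 * log (2 * π) + 1 / 2)
      + ({x | (a : ℝ) < |x|}.indicator (fun x => 4 * x ^ 2) x / σ ^ 2 / 2
        + ((1 / (a * σ)) ^ 2 / 2 + (exp ((1 / (a * σ)) ^ 2 / 8) - 1))) := by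
  have ha0 : (0 : ℝ) < a := by exact_mod_cast ha
  have hm := sum_discProb_mul_sq_le hσ ha x
  set δ := 1 / (a * σ) with hδ
  have hδ0 : 0 < δ := by positivity
  have hlog : log δ = -(log a + log σ) := by
    rw [hδ, one_div, log_inv, log_mul ha0.ne' hσ.ne']
  have hq := sum_gaussianPDFReal_le (x / σ) hδ0 (gridRange a)
  have hp := sum_discProb σ a x
  have hbound : ∀ r ∈ gridRange a, negMulLog (discProb σ a x r)
      ≤ (log a + log σ + 1 / 2 * log (2 * π) - 1) * discProb σ a x r
        + 1 / 2 * (discProb σ a x r * (r * δ - x / σ) ^ 2)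
        + δ * gaussianPDFReal 0 1 (r * δ - x / σ) := by
    intro r _
    have hφ := gaussianPDFReal_pos 0 1 (r * δ - x / σ) one_ne_zero
    have h := negMulLog_le (discProb_nonneg σ a x r) (mul_pos hδ0 hφ)
    rw [log_mul hδ0.ne' hφ.ne', log_gaussianPDFReal_zero_one, hlog] at h
    linarith
  rw [discEntropy_eq_sum]
  refine (Finset.sum_le_sum hbound).trans ?_
  rw [Finset.sum_add_distrib, Finset.sum_add_distrib, ← Finset.mul_sum, ← Finset.mul_sum, hp]
  linarith

lemma le_discEntropy {σ : ℝ} (hσ : 0 < σ) {a : ℕ} (ha : 2 ≤ a) (x : ℝ) :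
    log a + (log σ + 1 / 2 * log (2 * π) + 1 / 2)
      - ((2 * x ^ 2) * (log a + |log σ + 1 / 2 * log (2 * π)| + 1 / 2)
        + 2 * σ ^ 2 * (log a + |log σ + 1 / 2 * log (2 * π)|
          + (∫ z : ℝ, z ^ 4 ∂(gaussianReal 0 1)) / 2)) / ((a : ℝ) - 1) ^ 2
      ≤ discEntropy σ a x := by
  have ha2 : (2 : ℝ) ≤ a := by exact_mod_cast ha
  have ha0 : (0 : ℝ) < a := by linarith
  set c := log σ + 1 / 2 * log (2 * π) with hc
  set M := ∫ z : ℝ, z ^ 4 ∂(gaussianReal 0 1) with hM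
  set K := log a + |c| with hK
  set d := ((a : ℝ) - 1) ^ 2 with hd
  have hd0 : 0 < d := by
    have : (0 : ℝ) < a - 1 := by linarith
    positivity
  have hla : 0 ≤ log a := log_nonneg (by linarith)
  set I := Finset.Icc (-(a : ℤ) ^ 2 + 1) ((a : ℤ) ^ 2 - 1) with hI
  have hsub : I ⊆ gridRange a := Finset.Icc_subset_Icc (by linarith) (by linarith)
  have hW : Integrable (fun z : ℝ => log a + c + z ^ 2 / 2) (gaussianReal 0 1) :=
    (integrable_const _).add ((integrable_pow_gaussianReal 2).div_const 2)
  have hterm : ∀ r ∈ I,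
      ∫ z, tent (a * (x + σ * z) - r) * (log a + c + z ^ 2 / 2) ∂(gaussianReal 0 1)
        ≤ negMulLog (discProb σ a x r) := by
    intro r hr
    have h := integral_le_negMulLog_integral_tent (mul_pos ha0 hσ) (a * x - r)
    rw [hI, Finset.mem_Icc] at hr
    have h1 : -(a : ℝ) ^ 2 + 1 ≤ r := by exact_mod_cast hr.1
    have h2 : (r : ℝ) ≤ (a : ℝ) ^ 2 - 1 := by exact_mod_cast hr.2
    have e1 : ∀ z : ℝ, a * σ * z + (a * x - r) = a * (x + σ * z) - r := fun z => by ring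
    simp only [e1, log_mul ha0.ne' hσ.ne', add_assoc (log (a : ℝ)), ← hc] at h
    simp only [discProb_eq, tent_clamp_mul_sub ha0.le h1 h2]
    simp only [add_assoc, mul_comm _ (a : ℝ)] at h ⊢
    exact h
  have hquart : Integrable (fun z : ℝ =>
      (1 / 2 - (x ^ 2 + 2 * σ ^ 2 * K) / d) * z ^ 2 + (-(σ ^ 2 / d)) * z ^ 4)
      (gaussianReal 0 1) :=
    ((integrable_pow_gaussianReal 2).const_mul _).add
      ((integrable_pow_gaussianReal 4).const_mul _)
  have hpoly : ∫ z : ℝ, ((log a + c - 2 * x ^ 2 * K / d)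
        + ((1 / 2 - (x ^ 2 + 2 * σ ^ 2 * K) / d) * z ^ 2 + (-(σ ^ 2 / d)) * z ^ 4))
        ∂(gaussianReal 0 1)
      = log a + (c + 1 / 2)
        - ((2 * x ^ 2) * (K + 1 / 2) + 2 * σ ^ 2 * (K + M / 2)) / d := by
    rw [integral_add (integrable_const _) hquart,
      integral_add ((integrable_pow_gaussianReal 2).const_mul _)
        ((integrable_pow_gaussianReal 4).const_mul _),
      integral_const_mul, integral_const_mul, integral_sq_gaussianReal, ← hM]
    simp
    field_simp
    ring
  rw [← hpoly, discEntropy_eq_sum]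
  refine le_trans ?_ (Finset.sum_le_sum_of_subset_of_nonneg hsub fun r _ _ =>
    negMulLog_nonneg (discProb_nonneg σ a x r) (discProb_le_one σ a x r))
  refine le_trans ?_ (Finset.sum_le_sum hterm)
  have hti : ∀ r ∈ I, Integrable
      (fun z => tent (a * (x + σ * z) - r) * (log a + c + z ^ 2 / 2)) (gaussianReal 0 1) :=
    fun r _ => integrable_tent_comp_mul hW (by fun_prop)
  rw [← integral_finsetSum _ hti]
  refine integral_mono ((integrable_const _).add hquart)
    (integrable_finsetSum _ hti) fun z => ?_
  simp only
  rw [← Finset.sum_mul]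
  set χ := ∑ r ∈ I, tent (a * (x + σ * z) - r) with hχ
  have hχ0 : 0 ≤ χ := Finset.sum_nonneg fun _ _ => tent_nonneg _
  have hχ1 : χ ≤ 1 := sum_tent_le_one _ _
  have hχd : 1 - χ ≤ (x + σ * z) ^ 2 / d := by
    rcases le_or_gt |x + σ * z| (a - 1) with h | h
    · have hχe : χ = 1 := by
        rw [abs_le] at h
        refine sum_tent ?_ ?_
        · rw [Int.le_floor]
          push_cast
          nlinarith
        · have h3 : (⌊a * (x + σ * z)⌋ : ℝ) + 1 ≤ a ^ 2 - 1 := by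
            nlinarith [Int.floor_le (a * (x + σ * z))]
          exact_mod_cast h3
      rw [hχe, sub_self]
      positivity
    · have : 1 ≤ (x + σ * z) ^ 2 / d := by
        rw [one_le_div hd0, hd, ← sq_abs (x + σ * z)]
        have : (0 : ℝ) ≤ a - 1 := by linarith
        gcongr
      linarith
  have hcross : (x + σ * z) ^ 2 ≤ 2 * x ^ 2 + 2 * σ ^ 2 * z ^ 2 := by
    nlinarith [sq_nonneg (x - σ * z)]
  have hK0 : 0 ≤ K + z ^ 2 / 2 := by positivity
  have hWK : log a + c + z ^ 2 / 2 ≤ K + z ^ 2 / 2 := by linarith [le_abs_self c]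
  have h1 : (1 - χ) * (log a + c + z ^ 2 / 2)
      ≤ (2 * x ^ 2 + 2 * σ ^ 2 * z ^ 2) / d * (K + z ^ 2 / 2) :=
    (mul_le_mul_of_nonneg_left hWK (by linarith)).trans
      (mul_le_mul_of_nonneg_right (hχd.trans (by gcongr)) hK0)
  have e : (log a + c - 2 * x ^ 2 * K / d)
        + ((1 / 2 - (x ^ 2 + 2 * σ ^ 2 * K) / d) * z ^ 2 + (-(σ ^ 2 / d)) * z ^ 4)
      = (log a + c + z ^ 2 / 2) - (2 * x ^ 2 + 2 * σ ^ 2 * z ^ 2) / d * (K + z ^ 2 / 2) := by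
    field_simp
    ring
  rw [e]
  linarith

/-- For a real random variable `X` with law `ν` and finite variance,
`E_ν H(t_{σ,a}(x)) = log a + D(N(0,σ)) + o(1)` as `a → ∞`, where
`D(N(0,σ)) = ½ log(2πeσ²)`. -/
theorem discretized_entropy_expectation_limit
    (σ : ℝ) (hσ : 0 < σ) (ν : Measure ℝ) [IsProbabilityMeasure ν]
    (hvar : Integrable (fun x => x ^ 2) ν) :
    Tendsto (fun a : ℕ => (∫ x, discEntropy σ a x ∂ν) - Real.log a) atTop
      (nhds ((1 / 2) * Real.log (2 * π * Real.exp 1 * σ ^ 2))) := by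
  set c := log σ + 1 / 2 * log (2 * π) with hc
  have hconst : 1 / 2 * log (2 * π * exp 1 * σ ^ 2) = c + 1 / 2 := by
    rw [log_mul (by positivity) (by positivity), log_mul (by positivity) (by positivity),
      log_exp, log_pow, hc]
    push_cast
    ring
  set M := ∫ z : ℝ, z ^ 4 ∂(gaussianReal 0 1) with hM
  set V := ∫ x, x ^ 2 ∂ν with hV
  have hind : ∀ a : ℕ, Integrable ({x : ℝ | (a : ℝ) < |x|}.indicator fun x => 4 * x ^ 2) ν :=
    fun a => (hvar.const_mul 4).indicator (measurableSet_lt (by fun_prop) (by fun_prop))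
  have hquad : ∀ a : ℕ, Integrable (fun x => (2 * x ^ 2) * (log a + |c| + 1 / 2)
      + 2 * σ ^ 2 * (log a + |c| + M / 2)) ν := fun a =>
    ((hvar.const_mul 2).mul_const _).add (integrable_const _)
  have herr : ∀ a : ℕ, Integrable (fun x =>
      {x | (a : ℝ) < |x|}.indicator (fun x => 4 * x ^ 2) x / σ ^ 2 / 2
        + ((1 / (a * σ)) ^ 2 / 2 + (exp ((1 / (a * σ)) ^ 2 / 8) - 1))) ν := fun a =>
    (((hind a).div_const _).div_const _).add (integrable_const _)
  have hLi : ∀ a : ℕ, Integrable (fun x => log a + (c + 1 / 2)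
      - ((2 * x ^ 2) * (log a + |c| + 1 / 2)
        + 2 * σ ^ 2 * (log a + |c| + M / 2)) / ((a : ℝ) - 1) ^ 2) ν := fun a =>
    (integrable_const _).sub ((hquad a).div_const _)
  have hUi : ∀ a : ℕ, Integrable (fun x => log a + (c + 1 / 2)
      + ({x | (a : ℝ) < |x|}.indicator (fun x => 4 * x ^ 2) x / σ ^ 2 / 2
        + ((1 / (a * σ)) ^ 2 / 2 + (exp ((1 / (a * σ)) ^ 2 / 8) - 1)))) ν := fun a =>
    (integrable_const _).add (herr a)
  have hHi : ∀ a : ℕ, 2 ≤ a → Integrable (discEntropy σ a) ν := fun a ha =>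
    integrable_of_le_of_le (stronglyMeasurable_discEntropy σ a).aestronglyMeasurable
      (ae_of_all _ fun x => le_discEntropy hσ ha x)
      (ae_of_all _ fun x => discEntropy_le hσ (by omega) x) (hLi a) (hUi a)
  have hinv : Tendsto (fun a : ℕ => 1 / ((a : ℝ) * σ)) atTop (nhds 0) := by
    simp only [one_div]
    exact (tendsto_natCast_atTop_atTop.atTop_mul_const hσ).inv_tendsto_atTop
  have hpred : Tendsto (fun a : ℕ => ((a : ℝ) - 1)⁻¹) atTop (nhds 0) :=
    (tendsto_atTop_add_const_right _ (-1) tendsto_natCast_atTop_atTop).inv_tendsto_atTop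
  have htail : Tendsto (fun a : ℕ => ∫ x, {x : ℝ | (a : ℝ) < |x|}.indicator
      (fun x => 4 * x ^ 2) x ∂ν) atTop (nhds 0) := by
    rw [← integral_zero ℝ ℝ (μ := ν)]
    refine tendsto_integral_of_dominated_convergence (fun x => 4 * x ^ 2)
      (fun a => (hind a).aestronglyMeasurable) (hvar.const_mul 4)
      (fun a => ae_of_all _ fun x => ?_) (ae_of_all _ fun x => ?_)
    · refine (norm_indicator_le_norm_self _ _).trans (le_of_eq ?_)
      exact norm_of_nonneg (by positivity)
    · refine tendsto_const_nhds.congr' ?_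
      filter_upwards [eventually_ge_atTop ⌈|x|⌉₊] with a ha
      rw [Set.indicator_of_notMem]
      simpa using Nat.ceil_le.1 ha
  have hlogd : Tendsto (fun a : ℕ => log a / ((a : ℝ) - 1) ^ 2) atTop (nhds 0) := by
    refine squeeze_zero' (Eventually.of_forall fun a => ?_) ?_ hpred
    · exact div_nonneg (log_natCast_nonneg a) (sq_nonneg _)
    · filter_upwards [eventually_ge_atTop 2] with a ha
      have ha2 : (2 : ℝ) ≤ a := by exact_mod_cast ha
      have hpos : (0 : ℝ) < a - 1 := by linarith
      rw [div_le_iff₀ (by positivity), pow_two, inv_mul_cancel_left₀ hpos.ne']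
      exact log_le_sub_one_of_pos (by linarith)
  have hinvd : Tendsto (fun a : ℕ => (((a : ℝ) - 1) ^ 2)⁻¹) atTop (nhds 0) := by
    simpa using hpred.pow 2
  have hlow : Tendsto (fun a : ℕ => c + 1 / 2 - ((2 * V + 2 * σ ^ 2) * (log a / ((a : ℝ) - 1) ^ 2)
      + (2 * V * (|c| + 1 / 2) + 2 * σ ^ 2 * (|c| + M / 2)) * (((a : ℝ) - 1) ^ 2)⁻¹)) atTop
      (nhds (c + 1 / 2)) := by
    simpa using (tendsto_const_nhds (x := c + 1 / 2)).sub ((hlogd.const_mul (2 * V + 2 * σ ^ 2)).add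
      (hinvd.const_mul (2 * V * (|c| + 1 / 2) + 2 * σ ^ 2 * (|c| + M / 2))))
  have hupp : Tendsto (fun a : ℕ => c + 1 / 2
      + ((∫ x, {x : ℝ | (a : ℝ) < |x|}.indicator (fun x => 4 * x ^ 2) x ∂ν) / σ ^ 2 / 2
        + ((1 / (a * σ)) ^ 2 / 2 + (exp ((1 / (a * σ)) ^ 2 / 8) - 1)))) atTop
      (nhds (c + 1 / 2)) := by
    have hexp : Tendsto (fun a : ℕ => exp ((1 / (a * σ)) ^ 2 / 8)) atTop (nhds 1) := by
      simpa using ((hinv.pow 2).div_const 8).rexp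
    simpa using (tendsto_const_nhds (x := c + 1 / 2)).add (((htail.div_const (σ ^ 2)).div_const 2).add
      (((hinv.pow 2).div_const 2).add (hexp.sub_const 1)))
  rw [hconst]
  refine tendsto_of_tendsto_of_tendsto_of_le_of_le' hlow hupp ?_ ?_
  · filter_upwards [eventually_ge_atTop 2] with a ha
    have h := integral_mono (hLi a) (hHi a ha) fun x => le_discEntropy hσ ha x
    have e : ∫ x, (log a + (c + 1 / 2) - ((2 * x ^ 2) * (log a + |c| + 1 / 2)
        + 2 * σ ^ 2 * (log a + |c| + M / 2)) / ((a : ℝ) - 1) ^ 2) ∂ν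
        = log a + (c + 1 / 2) - (2 * V * (log a + |c| + 1 / 2)
        + 2 * σ ^ 2 * (log a + |c| + M / 2)) / ((a : ℝ) - 1) ^ 2 := by
      rw [integral_sub (integrable_const _) ((hquad a).div_const _), integral_div,
        integral_add ((hvar.const_mul 2).mul_const _) (integrable_const _),
        integral_mul_const, integral_const_mul]
      simp [hV]
    rw [e] at h
    simp only [div_eq_mul_inv] at h ⊢
    linarith
  · filter_upwards [eventually_ge_atTop 2] with a ha
    have h := integral_mono (hHi a ha) (hUi a) fun x => discEntropy_le hσ (by omega) x
    rw [integral_add (integrable_const _) (herr a),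
      integral_add (((hind a).div_const _).div_const _) (integrable_const _),
      integral_div, integral_div] at h
    simp only [integral_const, probReal_univ, one_smul] at h
    linarith
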